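/- Let C, A₁,…,A_m ∈ Sym(n), b ∈ ℝ^m, μ > 0, G ∈ Sym(n) a fixed symmetric matrix, 𝒜(X)_i = ⟨A_i,X⟩ with adjoint 𝒜*, residue r(U) = 𝒜(UUᵀ) − b, and L̂_μ(U) = ⟨C+G, UUᵀ⟩ + μ‖r(U)‖₂². If U ∈ ℝ^{n×k} is an ε-FOSP of L̂_μ (i.e., ‖∇L̂_μ(U)‖_F ≤ ε) and M = C + 2μ𝒜*(r(U)), then σ_k(U) · √(Σ_{i=1}^{k} σ_{n−i+1}(M+G)²) ≤ ε/2, where σ_{n−i+1}(M+G) are the k smallest singular values of M+G; equivalently, σ_k(U) ≤ ε / (2√(Σ_{i=1}^{k} σ_{n−i+1}(M+G)²)) whenever the denominator is nonzero. -/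

import Mathlib

open Matrix

attribute [local instance] Matrix.normedAddCommGroup Matrix.normedSpace

/-- Trace inner product `⟨A, B⟩ = Tr(Aᵀ B)` on square matrices. -/
noncomputable def mip {n : ℕ} (A B : Matrix (Fin n) (Fin n) ℝ) : ℝ := (Aᵀ * B).trace

/-- Frobenius inner product on rectangular matrices. -/
noncomputable def mipr {n k : ℕ} (A B : Matrix (Fin n) (Fin k) ℝ) : ℝ :=
  ∑ i, ∑ j, A i j * B i j

/-- Euclidean norm of a vector. -/
noncomputable def vnorm {k : ℕ} (z : Fin k → ℝ) : ℝ := Real.sqrt (∑ i, z i ^ 2)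

/-- Frobenius norm of a matrix. -/
noncomputable def fnorm {n k : ℕ} (A : Matrix (Fin n) (Fin k) ℝ) : ℝ :=
  Real.sqrt (∑ i, ∑ j, A i j ^ 2)

/-- The smallest singular value `σ_k(U)` of `U ∈ ℝ^{n×k}`: `min_{‖z‖₂ = 1} ‖U z‖₂`. -/
noncomputable def sigmaMin {n k : ℕ} (U : Matrix (Fin n) (Fin k) ℝ) : ℝ :=
  sInf {t | ∃ z : Fin k → ℝ, vnorm z = 1 ∧ t = vnorm (U.mulVec z)}

/-- `Σ_{i=1}^{k} σ_{n−i+1}(S)²`: the sum of the squares of the `k` smallest singular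
values of `S`, characterized (Ky Fan) as the minimum of `Σ_j ‖S v_j‖²` over orthonormal
`k`-frames `V = [v_1 ⋯ v_k]` (i.e. `Vᵀ V = I_k`). -/
noncomputable def kSmallestSingSq {n : ℕ} (S : Matrix (Fin n) (Fin n) ℝ) (k : ℕ) : ℝ :=
  sInf {t | ∃ V : Matrix (Fin n) (Fin k) ℝ, Vᵀ * V = 1 ∧
    t = ∑ j, ∑ i, (S.mulVec (fun i' => V i' j)) i ^ 2}

theorem mipr_eq_trace {n k : ℕ} (A B : Matrix (Fin n) (Fin k) ℝ) :
    mipr A B = (Aᵀ * B).trace := by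
  simp only [mipr, Matrix.trace, Matrix.diag, Matrix.mul_apply, Matrix.transpose_apply]
  exact Finset.sum_comm

theorem mipr_self_eq_zero {n k : ℕ} {A : Matrix (Fin n) (Fin k) ℝ} (h : mipr A A = 0) :
    A = 0 := by
  rw [mipr_eq_trace, ← Matrix.conjTranspose_eq_transpose_of_trivial] at h
  exact Matrix.trace_conjTranspose_mul_self_eq_zero_iff.mp h

theorem eq_of_forall_mipr_eq {n k : ℕ} {A B : Matrix (Fin n) (Fin k) ℝ}
    (h : ∀ V, mipr A V = mipr B V) : A = B := by
  refine sub_eq_zero.mp (mipr_self_eq_zero ?_)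
  have h' := h (A - B)
  rw [mipr_eq_trace] at h' ⊢
  rw [Matrix.transpose_sub, Matrix.sub_mul, Matrix.trace_sub, h', mipr_eq_trace, sub_self]

theorem fnorm_sq {n k : ℕ} (A : Matrix (Fin n) (Fin k) ℝ) :
    fnorm A ^ 2 = (Aᵀ * A).trace := by
  rw [fnorm, Real.sq_sqrt (by positivity), ← mipr_eq_trace]
  simp only [mipr, sq]

theorem vnorm_sq {k : ℕ} (z : Fin k → ℝ) : vnorm z ^ 2 = z ⬝ᵥ z := by
  rw [vnorm, Real.sq_sqrt (by positivity)]
  simp only [dotProduct, sq]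

theorem mip_add_smul_mul_transpose {n k : ℕ} {B : Matrix (Fin n) (Fin n) ℝ} (hB : B.IsSymm)
    (U V : Matrix (Fin n) (Fin k) ℝ) (t : ℝ) :
    mip B ((U + t • V) * (U + t • V)ᵀ) =
      mip B (U * Uᵀ) + t * (2 * mipr (B * U) V) + t ^ 2 * mip B (V * Vᵀ) := by
  have h₁ : (B * (U * Vᵀ)).trace = ((B * U)ᵀ * V).trace := by
    rw [← Matrix.mul_assoc, ← Matrix.trace_transpose, Matrix.transpose_mul,
      Matrix.transpose_transpose, Matrix.trace_mul_comm]
  have h₂ : (B * (V * Uᵀ)).trace = ((B * U)ᵀ * V).trace := by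
    rw [Matrix.transpose_mul, hB.eq, Matrix.mul_assoc, Matrix.trace_mul_comm Uᵀ,
      Matrix.mul_assoc]
  simp only [mip, mipr_eq_trace, hB.eq, Matrix.transpose_add, Matrix.transpose_smul,
    Matrix.add_mul, Matrix.mul_add, Matrix.smul_mul, Matrix.mul_smul, Matrix.trace_add,
    Matrix.trace_smul, smul_eq_mul, h₁, h₂]
  ring

theorem hasLineDerivAt_mip_mul_transpose {n k : ℕ} {B : Matrix (Fin n) (Fin n) ℝ}
    (hB : B.IsSymm) (U V : Matrix (Fin n) (Fin k) ℝ) :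
    HasLineDerivAt ℝ (fun W : Matrix (Fin n) (Fin k) ℝ => mip B (W * Wᵀ))
      (2 * mipr (B * U) V) U V := by
  simp only [HasLineDerivAt, mip_add_smul_mul_transpose hB]
  have h := (((hasDerivAt_id (0 : ℝ)).mul_const (2 * mipr (B * U) V)).const_add
    (mip B (U * Uᵀ))).add (((hasDerivAt_id (0 : ℝ)).pow 2).mul_const (mip B (V * Vᵀ)))
  convert h using 1 <;> simp
  rfl

theorem differentiable_mip_mul_transpose {n k : ℕ} (B : Matrix (Fin n) (Fin n) ℝ) :
    Differentiable ℝ (fun W : Matrix (Fin n) (Fin k) ℝ => mip B (W * Wᵀ)) := by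
  have h (i : Fin n) (j : Fin k) :
      Differentiable ℝ (fun W : Matrix (Fin n) (Fin k) ℝ => W i j) :=
    (LinearMap.toContinuousLinearMap (Matrix.entryLinearMap ℝ ℝ i j)).differentiable
  simp only [mip, Matrix.trace, Matrix.diag, Matrix.mul_apply, Matrix.transpose_apply]
  fun_prop

theorem fderiv_penalized_objective {n m k : ℕ} {D : Matrix (Fin n) (Fin n) ℝ} (hD : D.IsSymm)
    {A : Fin m → Matrix (Fin n) (Fin n) ℝ} (hA : ∀ i, (A i).IsSymm) (b : Fin m → ℝ) (μ : ℝ)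
    (U V : Matrix (Fin n) (Fin k) ℝ) :
    fderiv ℝ (fun W : Matrix (Fin n) (Fin k) ℝ =>
        mip D (W * Wᵀ) + μ * ∑ i, (mip (A i) (W * Wᵀ) - b i) ^ 2) U V =
      mipr ((2 : ℝ) • ((D + (2 * μ) • ∑ i, (mip (A i) (U * Uᵀ) - b i) • A i) * U)) V := by
  have hdiff : DifferentiableAt ℝ (fun W : Matrix (Fin n) (Fin k) ℝ =>
      mip D (W * Wᵀ) + μ * ∑ i, (mip (A i) (W * Wᵀ) - b i) ^ 2) U := by
    have h₁ := differentiable_mip_mul_transpose (k := k) D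
    have h₂ (i : Fin m) := differentiable_mip_mul_transpose (k := k) (A i)
    fun_prop
  have hline := HasDerivAt.add (hasLineDerivAt_mip_mul_transpose hD U V)
    ((HasDerivAt.fun_sum fun i (_ : i ∈ Finset.univ) =>
      (((hasLineDerivAt_mip_mul_transpose (hA i) U V).sub_const (b i)).pow 2)).const_mul μ)
  refine hdiff.lineDeriv_eq_fderiv.symm.trans (hline.deriv.trans ?_)
  simp only [mipr_eq_trace, zero_smul, add_zero, Matrix.add_mul, Matrix.smul_mul,
    Matrix.sum_mul, Matrix.transpose_add, Matrix.transpose_smul, Matrix.transpose_sum,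
    Matrix.trace_add, Matrix.trace_smul, Matrix.trace_sum, smul_eq_mul, mul_add,
    Finset.mul_sum]
  congr 1
  refine Finset.sum_congr rfl fun i _ => ?_
  push_cast
  ring

theorem sigmaMin_le_vnorm {n k : ℕ} (U : Matrix (Fin n) (Fin k) ℝ) {z : Fin k → ℝ}
    (hz : vnorm z = 1) : sigmaMin U ≤ vnorm (U *ᵥ z) :=
  csInf_le ⟨0, by rintro _ ⟨_, _, rfl⟩; exact Real.sqrt_nonneg _⟩ ⟨z, hz, rfl⟩

theorem sigmaMin_nonneg {n k : ℕ} (U : Matrix (Fin n) (Fin k) ℝ) : 0 ≤ sigmaMin U :=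
  Real.sInf_nonneg (by rintro _ ⟨_, _, rfl⟩; exact Real.sqrt_nonneg _)

theorem kSmallestSingSq_le {n k : ℕ} (S : Matrix (Fin n) (Fin n) ℝ)
    {V : Matrix (Fin n) (Fin k) ℝ} (hV : Vᵀ * V = 1) :
    kSmallestSingSq S k ≤ ∑ j, ∑ i, ((S * V) i j) ^ 2 :=
  csInf_le ⟨0, by rintro _ ⟨_, _, rfl⟩; positivity⟩ ⟨V, hV, rfl⟩

theorem exists_orthogonal_diagonalization {n k : ℕ} (U : Matrix (Fin n) (Fin k) ℝ) :
    ∃ (Q : Matrix (Fin k) (Fin k) ℝ) (d : Fin k → ℝ),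
      Qᵀ * Q = 1 ∧ Q * Qᵀ = 1 ∧ (U * Q)ᵀ * (U * Q) = Matrix.diagonal d := by
  have hH : (Uᵀ * U).IsHermitian := Matrix.isHermitian_conjTranspose_mul_self U
  have hQ := hH.eigenvectorUnitary.2
  rw [Matrix.mem_unitaryGroup_iff'] at hQ
  refine ⟨hH.eigenvectorUnitary, hH.eigenvalues, hQ, mul_eq_one_comm.mp hQ, ?_⟩
  have h := hH.conjStarAlgAut_star_eigenvectorUnitary
  simp only [Unitary.conjStarAlgAut_apply] at h
  rw [Matrix.transpose_mul]
  simpa [Matrix.mul_assoc, Matrix.star_eq_conjTranspose,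
    Matrix.conjTranspose_eq_transpose_of_trivial, Function.comp_def] using h

theorem sigmaMin_sq_mul_kSmallestSingSq_le {n k : ℕ} (S : Matrix (Fin n) (Fin n) ℝ)
    (U : Matrix (Fin n) (Fin k) ℝ) :
    sigmaMin U ^ 2 * kSmallestSingSq S k ≤ fnorm (S * U) ^ 2 := by
  rcases (sigmaMin_nonneg U).eq_or_lt with h0 | hpos
  · rw [← h0]
    simpa using sq_nonneg (fnorm (S * U))
  obtain ⟨Q, d, hQ, hQ', hd⟩ := exists_orthogonal_diagonalization U
  have hσd (j : Fin k) : sigmaMin U ^ 2 ≤ d j := by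
    have hz : vnorm (fun i => Q i j) = 1 := by
      have h : vnorm (fun i => Q i j) ^ 2 = 1 := by
        rw [vnorm_sq]
        simpa [Matrix.mul_apply, dotProduct] using congrFun (congrFun hQ j) j
      exact (pow_eq_one_iff_of_nonneg (Real.sqrt_nonneg _) two_ne_zero).mp h
    calc sigmaMin U ^ 2 ≤ vnorm (U *ᵥ fun i => Q i j) ^ 2 :=
          pow_le_pow_left₀ hpos.le (sigmaMin_le_vnorm U hz) 2
      _ = ((U * Q)ᵀ * (U * Q)) j j := vnorm_sq _
      _ = d j := by rw [hd, Matrix.diagonal_apply_eq]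
  have hdpos (j : Fin k) : 0 < d j := (pow_pos hpos 2).trans_le (hσd j)
  set e : Fin k → ℝ := fun j => (√(d j))⁻¹ with he
  have hV : (U * Q * Matrix.diagonal e)ᵀ * (U * Q * Matrix.diagonal e) = 1 := by
    rw [Matrix.transpose_mul, Matrix.diagonal_transpose, Matrix.mul_assoc,
      ← Matrix.mul_assoc (U * Q)ᵀ, hd, Matrix.diagonal_mul_diagonal,
      Matrix.diagonal_mul_diagonal, ← Matrix.diagonal_one]
    congr 1
    funext j
    have h := Real.sq_sqrt (hdpos j).le
    have h' := Real.sqrt_pos.mpr (hdpos j)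
    simp only [he]
    field_simp
    linarith
  have hfrob : fnorm (S * U) ^ 2 = fnorm (S * (U * Q)) ^ 2 := by
    rw [fnorm_sq, fnorm_sq, ← Matrix.mul_assoc S U Q, Matrix.transpose_mul (S * U) Q,
      Matrix.mul_assoc Qᵀ, Matrix.trace_mul_comm Qᵀ, Matrix.mul_assoc, Matrix.mul_assoc (S * U),
      hQ', Matrix.mul_one]
  calc sigmaMin U ^ 2 * kSmallestSingSq S k
      ≤ sigmaMin U ^ 2 * ∑ j, ∑ i, ((S * (U * Q * Matrix.diagonal e)) i j) ^ 2 :=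
        mul_le_mul_of_nonneg_left (kSmallestSingSq_le S hV) (sq_nonneg _)
    _ ≤ ∑ j, ∑ i, ((S * (U * Q)) i j) ^ 2 := by
        rw [Finset.mul_sum]
        refine Finset.sum_le_sum fun j _ => ?_
        rw [Finset.mul_sum]
        refine Finset.sum_le_sum fun i _ => ?_
        rw [← Matrix.mul_assoc, Matrix.mul_diagonal, he, mul_pow, inv_pow,
          Real.sq_sqrt (hdpos j).le, mul_left_comm]
        refine mul_le_of_le_one_right (sq_nonneg _) ?_
        rw [← div_eq_mul_inv]
        exact div_le_one_of_le₀ (hσd j) (hdpos j).le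
    _ = fnorm (S * U) ^ 2 := by
        rw [hfrob, fnorm, Real.sq_sqrt (by positivity), Finset.sum_comm]

/-- If `U` is an `ε`-FOSP of the perturbed objective
`L̂_μ(U) = ⟨C+G, UUᵀ⟩ + μ‖𝒜(UUᵀ) − b‖₂²` and `M = C + 2μ𝒜*(r(U))`, then
`σ_k(U)·√(Σ_{i=1}^{k} σ_{n−i+1}(M+G)²) ≤ ε/2`. -/
theorem eps_fosp_sigma_k_bound {n m k : ℕ} (hkn : k ≤ n)
    (C G : Matrix (Fin n) (Fin n) ℝ) (hC : C.IsSymm) (hG : G.IsSymm)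
    (A : Fin m → Matrix (Fin n) (Fin n) ℝ) (hA : ∀ i, (A i).IsSymm)
    (b : Fin m → ℝ) (μ ε : ℝ) (hμ : 0 < μ) (hε : 0 < ε)
    (U : Matrix (Fin n) (Fin k) ℝ)
    (hgrad : ∃ g : Matrix (Fin n) (Fin k) ℝ,
      (∀ V, fderiv ℝ (fun W : Matrix (Fin n) (Fin k) ℝ =>
        mip (C + G) (W * Wᵀ) + μ * ∑ i, (mip (A i) (W * Wᵀ) - b i) ^ 2) U V = mipr g V) ∧
      fnorm g ≤ ε) :
    sigmaMin U *
      Real.sqrt (kSmallestSingSq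
        ((C + (2 * μ) • ∑ i, (mip (A i) (U * Uᵀ) - b i) • A i) + G) k) ≤ ε / 2 := by
  obtain ⟨g, hg, hgε⟩ := hgrad
  rw [add_right_comm]
  set S := C + G + (2 * μ) • ∑ i, (mip (A i) (U * Uᵀ) - b i) • A i
  have hgS : g = (2 : ℝ) • (S * U) := eq_of_forall_mipr_eq fun V => by
    rw [← hg V, fderiv_penalized_objective (hC.add hG) hA]
  have hSU : fnorm (S * U) ≤ ε / 2 := by
    have h : fnorm g ^ 2 = (2 * fnorm (S * U)) ^ 2 := by
      rw [mul_pow, fnorm_sq, fnorm_sq, hgS, Matrix.transpose_smul, Matrix.smul_mul,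
        Matrix.mul_smul, Matrix.trace_smul, Matrix.trace_smul, smul_eq_mul, smul_eq_mul]
      ring
    have hn (X : Matrix (Fin n) (Fin k) ℝ) : 0 ≤ fnorm X := Real.sqrt_nonneg _
    have h' := (sq_eq_sq₀ (hn g) (mul_nonneg zero_le_two (hn (S * U)))).mp h
    linarith
  have hκ : 0 ≤ kSmallestSingSq S k :=
    Real.sInf_nonneg (by rintro _ ⟨_, _, rfl⟩; positivity)
  refine le_trans (abs_le_of_sq_le_sq' ?_ (Real.sqrt_nonneg _)).2 hSU
  rw [mul_pow, Real.sq_sqrt hκ]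
  exact sigmaMin_sq_mul_kSmallestSingSq_le S U
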